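/- Let x, y ∈ S_∞, let i ≥ 1, and let j, k ∈ {i, i+1}. Then ins_j(x) ≤ ins_k(y) in Bruhat order if and only if j ≤ k and x ≤ y in Bruhat order. -/

import Mathlib

/-!
Statement 14.  Let `x, y ∈ S_∞`, let `i ≥ 1`, and `j, k ∈ {i, i+1}`.  Then
`ins_j(x) ≤ ins_k(y)` in Bruhat order iff `j ≤ k` and `x ≤ y` in Bruhat order.
(Permutations of the positive integers are modelled 0-indexed on `ℕ`, so the positions
`{i, i+1}` for `i ≥ 1` become `{i, i+1}` for `i ≥ 0`.)
-/

/-- Permutations of the positive integers are modelled by `Equiv.Perm ℕ`, the positive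
integer `p` corresponding to `p − 1 : ℕ`.  The insertion map `ins_i` (here `ins (i-1)`,
`0`-indexed) sends `j ↦ w(j) + 1` for `j < i`, `i ↦ 0`, and `j ↦ w(j−1) + 1` for `j > i`. -/
def ins (i : ℕ) (w : Equiv.Perm ℕ) : Equiv.Perm ℕ where
  toFun j := if j < i then w j + 1 else if j = i then 0 else w (j - 1) + 1
  invFun b := if b = 0 then i else if w.symm (b - 1) < i then w.symm (b - 1) else w.symm (b - 1) + 1
  left_inv := by
    intro j
    dsimp only
    by_cases h1 : j < i
    · rw [if_pos h1, if_neg (by omega : ¬ (w j + 1 = 0)), Nat.add_sub_cancel,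
        Equiv.symm_apply_apply, if_pos h1]
    · by_cases h2 : j = i
      · rw [if_neg h1, if_pos h2, if_pos rfl, h2]
      · rw [if_neg h1, if_neg h2, if_neg (by omega : ¬ (w (j - 1) + 1 = 0)),
          Nat.add_sub_cancel, Equiv.symm_apply_apply,
          if_neg (by omega : ¬ (j - 1 < i)), Nat.sub_add_cancel (by omega)]
  right_inv := by
    intro b
    dsimp only
    by_cases hb : b = 0
    · rw [if_pos hb, if_neg (lt_irrefl i), if_pos rfl, hb]
    · rw [if_neg hb]
      by_cases hc : w.symm (b - 1) < i
      · rw [if_pos hc, if_pos hc, Equiv.apply_symm_apply, Nat.sub_add_cancel (by omega)]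
      · rw [if_neg hc, if_neg (by omega : ¬ (w.symm (b - 1) + 1 < i)),
          if_neg (by omega : ¬ (w.symm (b - 1) + 1 = i)), Nat.add_sub_cancel,
          Equiv.apply_symm_apply, Nat.sub_add_cancel (by omega)]

/-- The number `ℓ(u)` of inversions of `u`. -/
noncomputable def invCount (u : Equiv.Perm ℕ) : ℕ :=
  Set.ncard {p : ℕ × ℕ | p.1 < p.2 ∧ u p.2 < u p.1}

/-- The Bruhat order: `u ≤ v` iff there is a chain `u = w₀, …, w_m = v` where each
`w_{s+1} = w_s · τ_s` for a transposition `τ_s`, with `ℓ(w_{s+1}) > ℓ(w_s)`. -/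
noncomputable def bruhatLE (u v : Equiv.Perm ℕ) : Prop :=
  ∃ (m : ℕ) (c : ℕ → Equiv.Perm ℕ), c 0 = u ∧ c m = v ∧
    ∀ s < m, (∃ a b : ℕ, a ≠ b ∧ c (s + 1) = c s * Equiv.swap a b) ∧
      invCount (c s) < invCount (c (s + 1))

/-- `ℓ_a(u) = #{b ≥ a : u⁻¹(b) ≤ u⁻¹(a)}` (0-indexed: this is `ℓ_{a+1}` of the paper). -/
noncomputable def lA (a : ℕ) (u : Equiv.Perm ℕ) : ℕ :=
  Set.ncard {b : ℕ | a ≤ b ∧ u.symm b ≤ u.symm a}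

/-- `u` fixes all but finitely many points, i.e. `u ∈ S_∞`. -/
def finitary (u : Equiv.Perm ℕ) : Prop := {a : ℕ | u a ≠ a}.Finite

/-- `u ∈ S_n`: `u` fixes every point `j > n` (0-indexed: every `j ≥ n`). -/
def inSn (n : ℕ) (u : Equiv.Perm ℕ) : Prop := ∀ j, n ≤ j → u j = j

/-- The formal letters `r_j, t_j` (`j ≥ 1`); here `RTLetter.r k` stands for `r_{k+1}`
and `RTLetter.t k` for `t_{k+1}`. -/
inductive RTLetter : Type
  | r : ℕ → RTLetter
  | t : ℕ → RTLetter
deriving DecidableEq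

/-- One step of the recursion defining `(u(Ω), v(Ω))`:
`r_j` maps `(u,v) ↦ (ins_j u, ins_j v)` and `t_j` maps `(u,v) ↦ (ins_j u, ins_{j+1} v)`. -/
def stepRT (p : Equiv.Perm ℕ × Equiv.Perm ℕ) : RTLetter → Equiv.Perm ℕ × Equiv.Perm ℕ
  | .r k => (ins k p.1, ins k p.2)
  | .t k => (ins k p.1, ins (k + 1) p.2)

/-- The pair `(u(Ω), v(Ω))` attached to a sequence `Ω` (a list of letters, first letter
first):  `u(∅) = v(∅) = id`, and the last letter is applied outermost. -/
def uv (L : List RTLetter) : Equiv.Perm ℕ × Equiv.Perm ℕ := L.foldl stepRT (1, 1)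

/-- The letter at (0-indexed) position `p` of a sequence in `RTSeq_n` must lie in
`{r₁, t₁, …, r_{p}, t_{p}, r_{p+1}}` (1-indexed position `s = p+1`). -/
def validLetter (p : ℕ) : RTLetter → Prop
  | .r k => k ≤ p
  | .t k => k + 1 ≤ p

/-- `Ω ∈ RTSeq_n`: a sequence of `n` letters `X₁⋯X_n` with
`X_s ∈ {r₁, t₁, …, r_{s−1}, t_{s−1}, r_s}`. -/
def validSeq (n : ℕ) (L : List RTLetter) : Prop :=
  L.length = n ∧ ∀ p < L.length, validLetter p (L.getD p (.r 0))

/-- `|Ω|_t`, the number of letters of the form `t_j`. -/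
def countT (L : List RTLetter) : ℕ :=
  L.countP (fun X => match X with | .t _ => true | .r _ => false)

/-- `c_n`, the backwards long cycle `n 1 2 ⋯ (n−1)` (0-indexed on `ℕ`:
`0 ↦ n−1`, `j ↦ j−1` for `1 ≤ j ≤ n−1`, `j ↦ j` for `j ≥ n`). -/
def cB (n : ℕ) : Equiv.Perm ℕ where
  toFun j := if j = 0 then n - 1 else if j ≤ n - 1 then j - 1 else j
  invFun j := if j = n - 1 then 0 else if j < n - 1 then j + 1 else j
  left_inv := by
    intro j
    dsimp only
    split_ifs <;> (try exact absurd rfl ‹_›) <;> (try exact (‹False›).elim) <;> omega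
  right_inv := by
    intro j
    dsimp only
    split_ifs <;> (try exact absurd rfl ‹_›) <;> (try exact (‹False›).elim) <;> omega

/-- `Ω′` is obtained from `Ω` by replacing the letters `t_i` at some subset of the
positions by either `r_i` or `r_{i+1}`. -/
def isReplacement (L L' : List RTLetter) : Prop :=
  L'.length = L.length ∧
  ∀ p < L.length,
    L'.getD p (.r 0) = L.getD p (.r 0) ∨
    ∃ k, L.getD p (.r 0) = .t k ∧ (L'.getD p (.r 0) = .r k ∨ L'.getD p (.r 0) = .r (k + 1))


/-- The set of inversions of `u`. -/
def invSet (u : Equiv.Perm ℕ) : Set (ℕ × ℕ) := {p | p.1 < p.2 ∧ u p.2 < u p.1}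

/-- The order embedding of `ℕ` onto the complement of `{j}`. -/
def skip (j p : ℕ) : ℕ := if p < j then p else p + 1

/-- A single upward step in the Bruhat order. -/
def bruhatStep (u v : Equiv.Perm ℕ) : Prop :=
  (∃ a b : ℕ, a ≠ b ∧ v = u * Equiv.swap a b) ∧ invCount u < invCount v

lemma invCount_eq (u : Equiv.Perm ℕ) : invCount u = (invSet u).ncard := rfl

lemma skip_lt_skip_iff {j p q : ℕ} : skip j p < skip j q ↔ p < q := by
  unfold skip; split_ifs <;> omega

lemma skip_injective (j : ℕ) : Function.Injective (skip j) := by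
  intro p q h
  unfold skip at h
  split_ifs at h <;> omega

lemma skip_ne (j p : ℕ) : skip j p ≠ j := by
  unfold skip; split_ifs <;> omega

lemma eq_or_exists_skip (j n : ℕ) : n = j ∨ ∃ p, n = skip j p := by
  rcases lt_trichotomy n j with h | h | h
  · exact Or.inr ⟨n, by simp [skip, h]⟩
  · exact Or.inl h
  · exact Or.inr ⟨n - 1, by unfold skip; split_ifs <;> omega⟩

@[simp] lemma ins_self (j : ℕ) (w : Equiv.Perm ℕ) : ins j w j = 0 := by
  change (if j < j then w j + 1 else if j = j then 0 else w (j - 1) + 1) = 0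
  simp

@[simp] lemma ins_skip (j p : ℕ) (w : Equiv.Perm ℕ) : ins j w (skip j p) = w p + 1 := by
  change (if skip j p < j then w (skip j p) + 1 else if skip j p = j then 0
    else w (skip j p - 1) + 1) = w p + 1
  rw [if_neg (skip_ne j p)]
  unfold skip
  split_ifs <;> first | rfl | omega

lemma ins_symm_zero (j : ℕ) (w : Equiv.Perm ℕ) : (ins j w).symm 0 = j := by
  rw [Equiv.symm_apply_eq, ins_self]

lemma ins_inj {j k : ℕ} {x y : Equiv.Perm ℕ} (h : ins j x = ins k y) : j = k ∧ x = y := by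
  have hjk : j = k := by rw [← ins_symm_zero j x, h, ins_symm_zero]
  subst hjk
  refine ⟨rfl, Equiv.ext fun p => ?_⟩
  have := congrArg (fun u : Equiv.Perm ℕ => u (skip j p)) h
  simpa using this

lemma ins_mul_swap (j a b : ℕ) (w : Equiv.Perm ℕ) :
    ins j (w * Equiv.swap a b) = ins j w * Equiv.swap (skip j a) (skip j b) := by
  ext n
  rcases eq_or_exists_skip j n with rfl | ⟨p, rfl⟩
  · rw [Equiv.Perm.mul_apply, Equiv.swap_apply_of_ne_of_ne (skip_ne _ _).symm (skip_ne _ _).symm]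
    simp
  · rw [Equiv.Perm.mul_apply, ← (skip_injective j).map_swap]
    simp

lemma ins_succ (i : ℕ) (w : Equiv.Perm ℕ) :
    ins (i + 1) w = ins i w * Equiv.swap i (i + 1) := by
  have hi : skip i i = i + 1 := by simp [skip]
  have hi' : skip (i + 1) i = i := by simp [skip]
  ext n
  rw [Equiv.Perm.mul_apply]
  rcases eq_or_exists_skip (i + 1) n with rfl | ⟨p, rfl⟩
  · simp
  · rw [ins_skip]
    by_cases hp : p = i
    · subst hp
      rw [hi', Equiv.swap_apply_left, ← hi, ins_skip]
    · have h : skip (i + 1) p = skip i p := by unfold skip; split_ifs <;> omega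
      rw [h, Equiv.swap_apply_of_ne_of_ne (skip_ne _ _) (hi ▸ (skip_injective i).ne hp), ins_skip]

lemma finitary.exists_bound {u : Equiv.Perm ℕ} (hu : finitary u) : ∃ N, ∀ n, N ≤ n → u n = n := by
  obtain ⟨N, hN⟩ := hu.bddAbove
  refine ⟨N + 1, fun n hn => ?_⟩
  by_contra h
  have := hN h
  omega

lemma finitary.of_bound {u : Equiv.Perm ℕ} {N : ℕ} (h : ∀ n, N ≤ n → u n = n) : finitary u :=
  (Set.finite_Iio N).subset fun n hn => by
    by_contra hN
    exact hn (h n (by simpa using hN))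

lemma finitary_ins {u : Equiv.Perm ℕ} (hu : finitary u) (j : ℕ) : finitary (ins j u) := by
  obtain ⟨N, hN⟩ := hu.exists_bound
  refine finitary.of_bound (N := N + j + 1) fun n hn => ?_
  have h : n = skip j (n - 1) := by unfold skip; split_ifs <;> omega
  rw [h, ins_skip, hN _ (by omega)]
  unfold skip
  split_ifs <;> omega

lemma finitary.mul_swap {u : Equiv.Perm ℕ} (hu : finitary u) (a b : ℕ) :
    finitary (u * Equiv.swap a b) := by
  obtain ⟨N, hN⟩ := hu.exists_bound
  refine finitary.of_bound (N := N + a + b + 1) fun n hn => ?_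
  rw [Equiv.Perm.mul_apply, Equiv.swap_apply_of_ne_of_ne (by omega) (by omega), hN _ (by omega)]

lemma finitary.finite_invSet {u : Equiv.Perm ℕ} (hu : finitary u) : (invSet u).Finite := by
  obtain ⟨N, hN⟩ := hu.exists_bound
  refine ((Set.finite_Iio N).prod (Set.finite_Iio N)).subset ?_
  rintro ⟨p, q⟩ ⟨hpq, hinv⟩
  dsimp only at hpq hinv
  have hq : q < N := by
    by_contra! h
    rw [hN q h] at hinv
    have := u.injective (hN (u p) (by omega))
    omega
  exact ⟨hpq.trans hq, hq⟩

lemma invCount_mul_swap_lt {u : Equiv.Perm ℕ} (hu : finitary u) {a b : ℕ} (hab : a < b)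
    (h : u b < u a) : invCount (u * Equiv.swap a b) < invCount u := by
  set s := Equiv.swap a b with hs
  have hinvol : ∀ p, s (s p) = p := Equiv.swap_apply_self a b
  set f : ℕ × ℕ → ℕ × ℕ := fun p => if s p.1 < s p.2 then (s p.1, s p.2) else p with hf
  have hinj : Set.InjOn f (invSet (u * s)) := by
    rintro ⟨p, q⟩ ⟨hp, -⟩ ⟨p', q'⟩ ⟨hp', -⟩ he
    simp only [hf] at he hp hp'
    split_ifs at he with h1 h2 h2
    · simp only [Prod.mk.injEq, EmbeddingLike.apply_eq_iff_eq] at he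
      exact Prod.ext he.1 he.2
    · simp only [Prod.mk.injEq] at he
      rw [← he.1, ← he.2, hinvol, hinvol] at h2
      exact absurd hp h2
    · simp only [Prod.mk.injEq] at he
      rw [he.1, he.2, hinvol, hinvol] at h1
      exact absurd hp' h1
    · exact he
  have hsub : f '' invSet (u * s) ⊆ invSet u \ {(a, b)} := by
    rintro _ ⟨⟨p, q⟩, ⟨hp, hq⟩, rfl⟩
    simp only [Equiv.Perm.mul_apply] at hp hq
    simp only [hf]
    split_ifs with h1
    · refine ⟨⟨h1, hq⟩, ?_⟩
      rintro heq
      simp only [Set.mem_singleton_iff, Prod.mk.injEq] at heq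
      have e1 : p = b := by rw [← hinvol p, heq.1, hs, Equiv.swap_apply_left]
      have e2 : q = a := by rw [← hinvol q, heq.2, hs, Equiv.swap_apply_right]
      omega
    · refine ⟨⟨hp, ?_⟩, ?_⟩
      · simp only [hs, Equiv.swap_apply_def] at h1 hq ⊢
        grind
      · rintro heq
        simp only [Set.mem_singleton_iff, Prod.mk.injEq] at heq
        rw [heq.1, heq.2, hs, Equiv.swap_apply_left, Equiv.swap_apply_right] at hq
        omega
  rw [invCount_eq, invCount_eq, ← hinj.ncard_image]
  refine Set.ncard_lt_ncard ⟨hsub.trans Set.sdiff_subset, fun hle => ?_⟩ hu.finite_invSet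
  exact (hsub (hle (show (a, b) ∈ invSet u from ⟨hab, h⟩))).2 rfl

lemma invCount_ins {w : Equiv.Perm ℕ} (hw : finitary w) (j : ℕ) :
    invCount (ins j w) = invCount w + j := by
  have hset : invSet (ins j w) =
      Prod.map (skip j) (skip j) '' invSet w ∪ (fun p => (p, j)) '' Set.Iio j := by
    ext ⟨p, q⟩
    constructor
    · rintro ⟨hp, hq⟩
      dsimp only at hp hq
      rcases eq_or_exists_skip j q with rfl | ⟨q, rfl⟩
      · exact Or.inr ⟨p, hp, rfl⟩
      · rcases eq_or_exists_skip j p with rfl | ⟨p, rfl⟩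
        · simp at hq
        · exact Or.inl ⟨(p, q), ⟨skip_lt_skip_iff.1 hp, by simpa using hq⟩, rfl⟩
    · rintro (⟨⟨p, q⟩, ⟨hp, hq⟩, he⟩ | ⟨p, hp, he⟩)
      · rw [← he]
        exact ⟨skip_lt_skip_iff.2 hp, by simpa using hq⟩
      · rw [← he]
        have h : p = skip j p := by simp [skip, Set.mem_Iio.1 hp]
        refine ⟨hp, ?_⟩
        dsimp only
        rw [h, ins_skip, ins_self]
        omega
  have hdisj : Disjoint (Prod.map (skip j) (skip j) '' invSet w)
      ((fun p => (p, j)) '' Set.Iio j) := by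
    rw [Set.disjoint_left]
    rintro _ ⟨⟨p, q⟩, -, rfl⟩ ⟨r, -, he⟩
    exact skip_ne j q (congrArg Prod.snd he).symm
  rw [invCount_eq, hset, Set.ncard_union_eq hdisj (hw.finite_invSet.image _)
    ((Set.finite_Iio j).image _),
    Set.ncard_image_of_injective _ ((skip_injective j).prodMap (skip_injective j)),
    Set.ncard_image_of_injective _ fun _ _ h => congrArg Prod.fst h, Set.ncard_Iio_nat,
    invCount_eq]

lemma bruhatLE_iff_reflTransGen {u v : Equiv.Perm ℕ} :
    bruhatLE u v ↔ Relation.ReflTransGen bruhatStep u v := by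
  constructor
  · rintro ⟨m, c, rfl, rfl, h⟩
    induction m with
    | zero => exact .refl
    | succ m ih => exact (ih fun s hs => h s (by omega)).tail (h m (by omega))
  · intro h
    induction h with
    | refl => exact ⟨0, fun _ => u, rfl, rfl, fun s hs => absurd hs (by omega)⟩
    | @tail v w _ hvw ih =>
      obtain ⟨m, c, h0, hm, hc⟩ := ih
      refine ⟨m + 1, fun s => if s ≤ m then c s else w, by simpa using h0, by simp, fun s hs => ?_⟩
      rcases Nat.lt_succ_iff_lt_or_eq.1 hs with h | rfl
      · simpa [h.le, Nat.succ_le_of_lt h] using hc s h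
      · simpa [hm, bruhatStep] using hvw

lemma finitary.of_bruhatStep {u v : Equiv.Perm ℕ} (hu : finitary u) (h : bruhatStep u v) :
    finitary v := by
  obtain ⟨⟨a, b, -, rfl⟩, -⟩ := h
  exact hu.mul_swap a b

lemma invCount_ins_lt_iff {u v : Equiv.Perm ℕ} (hu : finitary u) (hv : finitary v) {j : ℕ} :
    invCount (ins j u) < invCount (ins j v) ↔ invCount u < invCount v := by
  rw [invCount_ins hu, invCount_ins hv]
  omega

/-- Along an upward step the position of the value `0` weakly increases. -/
lemma bruhatStep.symm_zero_le {u v : Equiv.Perm ℕ} (hu : finitary u) (h : bruhatStep u v) :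
    u.symm 0 ≤ v.symm 0 := by
  have key : ∀ c, c ≠ u.symm 0 → invCount u < invCount (u * Equiv.swap (u.symm 0) c) →
      u.symm 0 ≤ c := by
    intro c hc hlt
    by_contra! hcl
    refine hlt.not_gt ?_
    rw [Equiv.swap_comm]
    refine invCount_mul_swap_lt hu hcl ?_
    have hne : u c ≠ u (u.symm 0) := u.injective.ne hc
    rw [Equiv.apply_symm_apply] at hne ⊢
    omega
  obtain ⟨⟨a, b, hab, rfl⟩, hlt⟩ := h
  have hv : (u * Equiv.swap a b).symm 0 = Equiv.swap a b (u.symm 0) := by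
    rw [Equiv.symm_apply_eq, Equiv.Perm.mul_apply, Equiv.swap_apply_self, Equiv.apply_symm_apply]
  rw [hv]
  by_cases ha : u.symm 0 = a
  · rw [← ha] at hlt hab ⊢
    rw [Equiv.swap_apply_left]
    exact key b hab.symm hlt
  by_cases hb : u.symm 0 = b
  · rw [← hb] at hlt hab ⊢
    rw [Equiv.swap_apply_right]
    rw [Equiv.swap_comm] at hlt
    exact key a hab hlt
  · rw [Equiv.swap_apply_of_ne_of_ne ha hb]

lemma ins_mul_swap_symm_zero (j b : ℕ) (w : Equiv.Perm ℕ) :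
    (ins j w * Equiv.swap j b).symm 0 = b := by
  rw [Equiv.symm_apply_eq, Equiv.Perm.mul_apply, Equiv.swap_apply_right, ins_self]

/-- The result of an upward step from `ins j w` either keeps the value `0` in place, and then comes
from an upward step from `w`, or exchanges `0` with a value to its right. -/
lemma bruhatStep.of_ins {w v : Equiv.Perm ℕ} (hw : finitary w) {j : ℕ}
    (h : bruhatStep (ins j w) v) :
    (∃ w', bruhatStep w w' ∧ v = ins j w') ∨
      ∃ b, j < b ∧ v = ins j w * Equiv.swap j b := by
  have hle := h.symm_zero_le (finitary_ins hw j)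
  rw [ins_symm_zero] at hle
  obtain ⟨⟨a, b, hab, rfl⟩, hlt⟩ := h
  rcases eq_or_exists_skip j a with rfl | ⟨a, rfl⟩
  · rw [ins_mul_swap_symm_zero] at hle
    exact Or.inr ⟨b, lt_of_le_of_ne hle hab, rfl⟩
  rcases eq_or_exists_skip j b with rfl | ⟨b, rfl⟩
  · rw [Equiv.swap_comm] at hle ⊢
    rw [ins_mul_swap_symm_zero] at hle
    exact Or.inr ⟨_, lt_of_le_of_ne hle hab.symm, rfl⟩
  · rw [← ins_mul_swap] at hlt ⊢
    exact Or.inl ⟨_, ⟨⟨a, b, fun e => hab (congrArg _ e), rfl⟩,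
      (invCount_ins_lt_iff hw (hw.mul_swap a b)).1 hlt⟩, rfl⟩

lemma reflTransGen_bruhatStep_finitary {u v : Equiv.Perm ℕ}
    (h : Relation.ReflTransGen bruhatStep u v) (hu : finitary u) : finitary v := by
  induction h with
  | refl => exact hu
  | tail _ hvw ih => exact ih.of_bruhatStep hvw

lemma exists_eq_ins_of_reflTransGen {x v : Equiv.Perm ℕ} (hx : finitary x) {j : ℕ}
    (h : Relation.ReflTransGen bruhatStep (ins j x) v) (hv : v.symm 0 ≤ j + 1) :
    ∃ k y, v = ins k y ∧ j ≤ k ∧ Relation.ReflTransGen bruhatStep x y := by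
  induction h with
  | refl => exact ⟨j, x, rfl, le_rfl, .refl⟩
  | @tail v w hv' hvw ih =>
    have hle := hvw.symm_zero_le (reflTransGen_bruhatStep_finitary hv' (finitary_ins hx j))
    obtain ⟨k, y, rfl, hjk, hxy⟩ := ih (hle.trans hv)
    have hy := reflTransGen_bruhatStep_finitary hxy hx
    rcases hvw.of_ins hy with ⟨y', hy', rfl⟩ | ⟨b, hb, rfl⟩
    · exact ⟨k, y', rfl, hjk, hxy.tail hy'⟩
    · rw [ins_mul_swap_symm_zero] at hv
      obtain rfl : b = k + 1 := by omega
      exact ⟨k + 1, y, (ins_succ k y).symm, by omega, hxy⟩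

lemma reflTransGen_bruhatStep_ins {x y : Equiv.Perm ℕ} (hx : finitary x) (j : ℕ)
    (h : Relation.ReflTransGen bruhatStep x y) :
    Relation.ReflTransGen bruhatStep (ins j x) (ins j y) := by
  induction h with
  | refl => exact .refl
  | @tail v w hv hvw ih =>
    have hv' := reflTransGen_bruhatStep_finitary hv hx
    refine ih.tail ⟨?_, (invCount_ins_lt_iff hv' (hv'.of_bruhatStep hvw)).2 hvw.2⟩
    obtain ⟨⟨a, b, hab, rfl⟩, -⟩ := hvw
    exact ⟨_, _, (skip_injective j).ne hab, ins_mul_swap j a b v⟩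

lemma bruhatStep_ins_succ {y : Equiv.Perm ℕ} (hy : finitary y) (i : ℕ) :
    bruhatStep (ins i y) (ins (i + 1) y) := by
  refine ⟨⟨i, i + 1, by omega, ins_succ i y⟩, ?_⟩
  rw [invCount_ins hy, invCount_ins hy]
  omega

theorem stmt14 (x y : Equiv.Perm ℕ) (hx : finitary x) (hy : finitary y)
    (i j k : ℕ) (hj : j = i ∨ j = i + 1) (hk : k = i ∨ k = i + 1) :
    bruhatLE (ins j x) (ins k y) ↔ j ≤ k ∧ bruhatLE x y := by
  simp only [bruhatLE_iff_reflTransGen]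
  constructor
  · intro h
    obtain ⟨k', y', he, hjk, hxy⟩ :=
      exists_eq_ins_of_reflTransGen hx h (by rw [ins_symm_zero]; omega)
    obtain ⟨rfl, rfl⟩ := ins_inj he
    exact ⟨hjk, hxy⟩
  · rintro ⟨hjk, hxy⟩
    have h := reflTransGen_bruhatStep_ins hx j hxy
    obtain rfl | rfl : k = j ∨ k = j + 1 := by omega
    · exact h
    · exact h.tail (bruhatStep_ins_succ hy j)
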